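/- Let Φ be a Young function. (i) The Mackey topology τ(L_{Φ*},L_Φ) on L_{Φ*} is finer than the restriction to L_{Φ*} of the topology of convergence in probability. (ii) For every 0 ≤ ζ ∈ L_{Φ*}, the restriction of τ(L_{Φ*},L_Φ) to the order interval [−ζ,ζ] coincides with the restriction of the topology of convergence in probability; in particular τ(L_{Φ*},L_Φ) is metrisable on order bounded sets. (iii) If Φ satisfies the Δ2-condition, then on the closed unit ball B_{Φ*} = {ξ : E[Φ*(ξ)] ≤ 1} of L_{Φ*} one has the inclusions σ(L_{Φ*},L_Φ)|_{B_{Φ*}} ⊂ τ_{L_0}|_{B_{Φ*}} ⊂ τ(L_{Φ*},L_Φ)|_{B_{Φ*}}, where τ_{L_0} is the topology of convergence in probability. -/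

import Mathlib

open MeasureTheory Filter Topology Set
open scoped ENNReal

noncomputable section

namespace OrliczPaper

variable {Ω : Type*} [MeasurableSpace Ω]

/-- A (finite, coercive) Young function: an even convex function with `Φ 0 = 0`
and `Φ x / x → ∞` as `x → ∞`. -/
structure IsYoung (Φ : ℝ → ℝ) : Prop where
  even : ∀ x, Φ (-x) = Φ x
  convexOn : ConvexOn ℝ Set.univ Φ
  map_zero : Φ 0 = 0
  coercive : Tendsto (fun x => Φ x / x) atTop atTop

/-- The Δ₂-condition: `limsup_{x→∞} Φ(2x)/Φ(x) < ∞`, i.e. `Φ(2x) ≤ C Φ(x)`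
for all large `x`. -/
def Delta2 (Φ : ℝ → ℝ) : Prop :=
  ∃ C x₀ : ℝ, ∀ x ≥ x₀, Φ (2 * x) ≤ C * Φ x

/-- The conjugate Young function `Φ*(y) = sup_x (x y − Φ x)`. -/
def conj (Φ : ℝ → ℝ) (y : ℝ) : ℝ := ⨆ x : ℝ, x * y - Φ x

variable (P : Measure Ω)

/-- Membership in the Orlicz space `L_Φ`: a measurable function with
`E[Φ(l ξ)] < ∞` for some `l > 0`. -/
def MemOrlicz (Φ : ℝ → ℝ) (f : Ω → ℝ) : Prop :=
  Measurable f ∧ ∃ l : ℝ, 0 < l ∧ ∫⁻ ω, ENNReal.ofReal (Φ (l * f ω)) ∂P < ⊤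

/-- The Orlicz space `L_Φ`, as a set of (everywhere defined) measurable functions. -/
def Orlicz (Φ : ℝ → ℝ) : Set (Ω → ℝ) := {f | MemOrlicz P Φ f}

/-- The Luxemburg norm `‖f‖_Φ = inf {l > 0 : E[Φ(f/l)] ≤ 1}`. -/
def luxNorm (Φ : ℝ → ℝ) (f : Ω → ℝ) : ℝ :=
  sInf {l : ℝ | 0 < l ∧ ∫⁻ ω, ENNReal.ofReal (Φ (f ω / l)) ∂P ≤ 1}

/-- The Orlicz (dual) norm `‖f‖_{(Φ*)} = sup {E[g f] : E[Φ(g)] ≤ 1}`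
(the Young function `Φ` here is the one of the *predual*). -/
def orliczNorm (Φ : ℝ → ℝ) (f : Ω → ℝ) : ℝ :=
  sSup {r : ℝ | ∃ g : Ω → ℝ, Measurable g ∧
    (∫⁻ ω, ENNReal.ofReal (Φ (g ω)) ∂P) ≤ 1 ∧ r = ∫ ω, g ω * f ω ∂P}

/-- The bilinear pairing `⟨f, g⟩ = E[f g]`. -/
def pairing (f g : Ω → ℝ) : ℝ := ∫ ω, f ω * g ω ∂P

/-- The weak topology `σ(E, F)` on `E` induced by the pairing with `F`. -/
def weakT (E F : Set (Ω → ℝ)) : TopologicalSpace E :=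
  TopologicalSpace.induced
    (fun ξ : E => fun η : F => pairing P (ξ : Ω → ℝ) (η : Ω → ℝ)) inferInstance

/-- The absolutely convex (convex and balanced) `σ(F,E)`-compact subsets of `F`. -/
def dualSets (E F : Set (Ω → ℝ)) : Set (Set F) :=
  {A | Convex ℝ (Subtype.val '' A) ∧ Balanced ℝ (Subtype.val '' A) ∧
    @IsCompact _ (weakT P F E) A}

/-- The Mackey topology `τ(E, F)`: the topology on `E` of uniform convergence on
absolutely convex `σ(F,E)`-compact subsets of `F`. -/
def mackeyT (E F : Set (Ω → ℝ)) : TopologicalSpace E :=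
  TopologicalSpace.induced
    (fun ξ : E => UniformOnFun.ofFun (dualSets P E F)
      (fun η : F => pairing P (ξ : Ω → ℝ) (η : Ω → ℝ)))
    inferInstance

/-- A distance generating the topology of convergence in `P`-probability. -/
def probDist (f g : Ω → ℝ) : ℝ := ∫ ω, min |f ω - g ω| 1 ∂P

/-- The topology of convergence in probability, restricted to `E ⊆ L₀`. -/
def probT (E : Set (Ω → ℝ)) : TopologicalSpace E :=
  TopologicalSpace.generateFrom
    {U | ∃ f : E, ∃ ε : ℝ, 0 < ε ∧ U = {g : E | probDist P (f : Ω → ℝ) (g : Ω → ℝ) < ε}}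

/-- `L_∞`: essentially bounded measurable functions. -/
def Linf : Set (Ω → ℝ) := {f | Measurable f ∧ ∃ C : ℝ, ∀ᵐ ω ∂P, |f ω| ≤ C}

/-- `L_1`: integrable measurable functions. -/
def L1 : Set (Ω → ℝ) := {f | Measurable f ∧ Integrable f P}

/-- The essential supremum norm. -/
def linfNorm (f : Ω → ℝ) : ℝ := sInf {C : ℝ | 0 ≤ C ∧ ∀ᵐ ω ∂P, |f ω| ≤ C}

/-- Uniform integrability of a set of functions:
`sup_{f ∈ A} E[|f| 1_{|f| > N}] → 0`. -/
def UnifInt (A : Set (Ω → ℝ)) : Prop :=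
  Tendsto (fun N : ℕ => ⨆ f ∈ A, ∫⁻ ω in {ω | (N : ℝ) < |f ω|}, ENNReal.ofReal |f ω| ∂P)
    atTop (𝓝 0)

/-- Uniform integrability of a sequence of functions. -/
def UnifIntSeq (g : ℕ → Ω → ℝ) : Prop :=
  Tendsto (fun N : ℕ => ⨆ n, ∫⁻ ω in {ω | (N : ℝ) < |g n ω|}, ENNReal.ofReal |g n ω| ∂P)
    atTop (𝓝 0)

/-- The Cesàro means of a sequence of functions: `cesaro ξ N` is the average of
`ξ 0, …, ξ N`. -/
def cesaro (ξ : ℕ → Ω → ℝ) (N : ℕ) : Ω → ℝ :=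
  fun ω => (∑ i ∈ Finset.range (N + 1), ξ i ω) / (N + 1)

/-- `sup_n |ξ n| ∈ L_Φ` (order boundedness of the sequence `ξ` in `L_Φ`). -/
def supMem (Φ : ℝ → ℝ) (ξ : ℕ → Ω → ℝ) : Prop :=
  (∀ᵐ ω ∂P, BddAbove (Set.range fun n => |ξ n ω|)) ∧
    MemOrlicz P Φ (fun ω => ⨆ n, |ξ n ω|)

/-- `ξb` is a sequence of forward convex combinations of `ξ`:
`ξb n ∈ conv (ξ k ; k ≥ n)`. -/
def FwdConvComb (ξ ξb : ℕ → Ω → ℝ) : Prop :=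
  ∀ n, ξb n ∈ convexHull ℝ {g : Ω → ℝ | ∃ k ≥ n, g = ξ k}

/-- The left derivative of a convex function. -/
def leftDeriv (Φ : ℝ → ℝ) (y : ℝ) : ℝ :=
  ⨆ h : {h : ℝ // 0 < h}, (Φ y - Φ (y - (h : ℝ))) / (h : ℝ)

/-- `p_Φ(x) = sup_{y > x} y Φ'(y) / Φ(y)`. -/
def pPhiAt (Φ : ℝ → ℝ) (x : ℝ) : ℝ≥0∞ :=
  ⨆ y : {y : ℝ // x < y}, ENNReal.ofReal ((y : ℝ) * leftDeriv Φ (y : ℝ) / Φ (y : ℝ))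

/-- `p_Φ = inf_{x ≥ 0} p_Φ(x)`. -/
def pPhi (Φ : ℝ → ℝ) : ℝ≥0∞ := ⨅ x : {x : ℝ // 0 ≤ x}, pPhiAt Φ x

/-- `q_Φ = p_Φ / (p_Φ − 1)` (with `1/0 = ∞`). -/
def qPhi (Φ : ℝ → ℝ) : ℝ≥0∞ := pPhi Φ / (pPhi Φ - 1)

end OrliczPaper

namespace OrliczPaper

variable {Ω : Type*} [MeasurableSpace Ω] {P : Measure Ω} {Φ : ℝ → ℝ}

/-! ### Young functions and their conjugates -/

/-- An even convex function is monotone in the absolute value. -/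
lemma apply_le_of_abs_le (he : ∀ x, Φ (-x) = Φ x) (hc : ConvexOn ℝ univ Φ) {x y : ℝ}
    (h : |x| ≤ |y|) : Φ x ≤ Φ y := by
  have hy : Φ |y| = Φ y := by
    rcases abs_choice y with h | h <;> rw [h]
    exact he y
  have hx : x ∈ segment ℝ (-|y|) |y| := by
    rw [segment_eq_Icc (by linarith [abs_nonneg y])]
    exact abs_le.mp h
  simpa [he, hy] using hc.le_on_segment (mem_univ _) (mem_univ _) hx

lemma continuous_of_convexOn (hc : ConvexOn ℝ univ Φ) : Continuous Φ :=
  continuousOn_univ.mp (hc.continuousOn isOpen_univ)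

lemma IsYoung.nonneg (hΦ : IsYoung Φ) (x : ℝ) : 0 ≤ Φ x :=
  hΦ.map_zero ▸ apply_le_of_abs_le hΦ.even hΦ.convexOn (by simp)

lemma IsYoung.bddAbove_conj (hΦ : IsYoung Φ) (y : ℝ) :
    BddAbove (range fun x : ℝ => x * y - Φ x) := by
  obtain ⟨a, ha⟩ := eventually_atTop.mp (hΦ.coercive.eventually_ge_atTop |y|)
  refine ⟨max a 1 * |y|, ?_⟩
  rintro _ ⟨x, rfl⟩
  have hxy : x * y ≤ |x| * |y| := by rw [← abs_mul]; exact le_abs_self _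
  have hx : Φ |x| = Φ x := by
    rcases abs_choice x with h | h <;> rw [h]
    exact hΦ.even x
  dsimp only
  rcases le_total |x| (max a 1) with h | h
  · have := mul_le_mul_of_nonneg_right h (abs_nonneg y)
    linarith [hΦ.nonneg x]
  · have h1 : 0 < |x| := by linarith [le_max_right a 1]
    have h2 := ha |x| ((le_max_left _ _).trans h)
    rw [le_div_iff₀ h1, hx] at h2
    have : 0 ≤ max a 1 * |y| := by positivity
    linarith

/-- The Fenchel–Young inequality. -/
lemma IsYoung.mul_le (hΦ : IsYoung Φ) (x y : ℝ) : x * y ≤ Φ x + conj Φ y := by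
  linarith [le_ciSup (hΦ.bddAbove_conj y) x, show conj Φ y = ⨆ x : ℝ, x * y - Φ x from rfl]

lemma conj_even (hΦ : IsYoung Φ) (y : ℝ) : conj Φ (-y) = conj Φ y := by
  unfold conj
  rw [← (Equiv.neg ℝ).surjective.iSup_comp]
  simp [hΦ.even]

lemma conj_convexOn (hΦ : IsYoung Φ) : ConvexOn ℝ univ (conj Φ) := by
  refine ⟨convex_univ, fun y _ z _ a b ha hb hab => ?_⟩
  refine ciSup_le fun x => ?_
  have hy := mul_le_mul_of_nonneg_left (hΦ.mul_le x y) ha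
  have hz := mul_le_mul_of_nonneg_left (hΦ.mul_le x z) hb
  have hx : Φ x = a * Φ x + b * Φ x := by rw [← add_mul, hab, one_mul]
  simp only [smul_eq_mul]
  linarith

lemma conj_nonneg (hΦ : IsYoung Φ) (y : ℝ) : 0 ≤ conj Φ y := by
  simpa [hΦ.map_zero] using hΦ.mul_le 0 y

lemma IsYoung.abs_mul_le (hΦ : IsYoung Φ) (x y : ℝ) : |x * y| ≤ Φ x + conj Φ y := by
  refine abs_le'.mpr ⟨hΦ.mul_le x y, ?_⟩
  simpa [hΦ.even] using hΦ.mul_le (-x) y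

/-! ### Membership in Orlicz spaces -/

lemma integrable_of_lintegral_ofReal (hc : Continuous Φ) (h0 : ∀ x, 0 ≤ Φ x) {f : Ω → ℝ}
    (hf : Measurable f) (h : ∫⁻ ω, ENNReal.ofReal (Φ (f ω)) ∂P < ⊤) :
    Integrable (fun ω => Φ (f ω)) P :=
  (lintegral_ofReal_ne_top_iff_integrable (hc.measurable.comp hf).aestronglyMeasurable
    (ae_of_all _ fun _ => h0 _)).mp h.ne

lemma integrable_mul_of_memOrlicz (hΦ : IsYoung Φ) {ξ η : Ω → ℝ} (hξ : MemOrlicz P (conj Φ) ξ)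
    (hη : MemOrlicz P Φ η) : Integrable (fun ω => ξ ω * η ω) P := by
  obtain ⟨hξm, l, hl, hξ⟩ := hξ
  obtain ⟨hηm, m, hm, hη⟩ := hη
  have h1 := integrable_of_lintegral_ofReal (continuous_of_convexOn (conj_convexOn hΦ))
    (conj_nonneg hΦ) (hξm.const_mul l) hξ
  have h2 := integrable_of_lintegral_ofReal (continuous_of_convexOn hΦ.convexOn)
    hΦ.nonneg (hηm.const_mul m) hη
  refine ((h2.add h1).const_mul (m * l)⁻¹).mono' (hξm.mul hηm).aestronglyMeasurable
    (ae_of_all _ fun ω => ?_)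
  have h := hΦ.abs_mul_le (m * η ω) (l * ξ ω)
  rw [show m * η ω * (l * ξ ω) = (m * l) * (ξ ω * η ω) by ring, abs_mul,
    abs_of_pos (mul_pos hm hl)] at h
  rw [Real.norm_eq_abs, le_inv_mul_iff₀ (mul_pos hm hl)]
  exact h

lemma memOrlicz_of_abs_le [IsFiniteMeasure P] (hΦ : IsYoung Φ) {η : Ω → ℝ} (hη : Measurable η)
    {C : ℝ} (h : ∀ ω, |η ω| ≤ C) : MemOrlicz P Φ η := by
  refine ⟨hη, 1, one_pos, ?_⟩
  calc ∫⁻ ω, ENNReal.ofReal (Φ (1 * η ω)) ∂P ≤ ∫⁻ _, ENNReal.ofReal (Φ C) ∂P := by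
        refine lintegral_mono fun ω => ENNReal.ofReal_le_ofReal ?_
        exact apply_le_of_abs_le hΦ.even hΦ.convexOn
          (by simpa using (h ω).trans (le_abs_self C))
    _ < ⊤ := by simp [ENNReal.mul_lt_top]

lemma integrable_of_memOrlicz_conj [IsFiniteMeasure P] (hΦ : IsYoung Φ) {ξ : Ω → ℝ}
    (hξ : MemOrlicz P (conj Φ) ξ) : Integrable ξ P := by
  simpa using integrable_mul_of_memOrlicz hΦ hξ
    (memOrlicz_of_abs_le hΦ (measurable_const (a := (1 : ℝ))) (C := 1) (by simp))

/-- The Orlicz space `L_{Φ*}` is solid. -/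
lemma MemOrlicz.of_abs_le (hΦ : IsYoung Φ) {ξ ζ : Ω → ℝ} {c : ℝ} (hc : 0 < c)
    (hζ : MemOrlicz P (conj Φ) ζ) (hξ : Measurable ξ) (h : ∀ᵐ ω ∂P, |ξ ω| ≤ c * ζ ω) :
    MemOrlicz P (conj Φ) ξ := by
  obtain ⟨-, l, hl, hζ⟩ := hζ
  refine ⟨hξ, l / c, div_pos hl hc, lt_of_le_of_lt (lintegral_mono_ae ?_) hζ⟩
  filter_upwards [h] with ω hω
  refine ENNReal.ofReal_le_ofReal (apply_le_of_abs_le (conj_even hΦ) (conj_convexOn hΦ) ?_)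
  rw [abs_mul, abs_mul, abs_of_pos (div_pos hl hc), abs_of_pos hl, div_mul_eq_mul_div,
    div_le_iff₀ hc, mul_assoc]
  refine mul_le_mul_of_nonneg_left ?_ hl.le
  calc |ξ ω| ≤ c * ζ ω := hω
    _ ≤ |ζ ω| * c := by rw [mul_comm]; exact mul_le_mul_of_nonneg_right (le_abs_self _) hc.le

/-- The tails `E[φ 1_{ψ > M}]` of an integrable function are small. -/
lemma exists_integral_indicator_lt {φ ψ : Ω → ℝ} (hφ : Integrable φ P) (hψ : Measurable ψ)
    {ε : ℝ} (hε : 0 < ε) :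
    ∃ M : ℝ, 1 ≤ M ∧ ∫ ω, {ω | M < ψ ω}.indicator φ ω ∂P < ε := by
  have hlim : Tendsto (fun n : ℕ => ∫ ω, {ω | (n : ℝ) < ψ ω}.indicator φ ω ∂P) atTop
      (𝓝 (∫ _, (0 : ℝ) ∂P)) := by
    refine tendsto_integral_of_dominated_convergence (fun ω => ‖φ ω‖) (fun n => ?_) hφ.norm
      (fun n => ae_of_all _ fun ω => norm_indicator_le_norm_self _ _) (ae_of_all _ fun ω => ?_)
    · exact hφ.aestronglyMeasurable.indicator (measurableSet_lt measurable_const hψ)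
    · refine tendsto_const_nhds.congr' ?_
      filter_upwards [eventually_ge_atTop ⌈ψ ω⌉₊] with n hn
      rw [indicator_of_notMem]
      simpa using Nat.ceil_le.mp hn
  rw [integral_zero] at hlim
  obtain ⟨n, hn, hn1⟩ := ((hlim.eventually_lt_const hε).and (eventually_ge_atTop 1)).exists
  exact ⟨n, by exact_mod_cast hn1, hn⟩

end OrliczPaper

namespace OrliczPaper

/-! ### A joint continuity property of separately continuous functions -/

section JointContinuity

variable {X Y : Type*} [PseudoMetricSpace X] [TopologicalSpace Y]

/-- If the sections of a separately continuous function oscillate by more than `3ε` on every ball,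
then on every ball they separate two points which are not distinguished by a given finite set. -/
lemma exists_pair_of_oscillation {A : Set Y} (hA : IsCompact A) {f : X → Y → ℝ}
    (hfX : ∀ y ∈ A, Continuous fun x => f x y) (hfY : ∀ x, Continuous (f x)) {ε : ℝ} (hε : 0 < ε)
    (hosc : ∀ x r, 0 < r → ∃ x' ∈ Metric.ball x r, ∃ y ∈ A, 3 * ε < |f x' y - f x y|)
    (S : Finset X) {δ : ℝ} (hδ : 0 < δ) (c : X) {r : ℝ} (hr : 0 < r) :
    ∃ u ∈ Metric.ball c r, ∃ y ∈ A, ∃ z ∈ A, (∀ x ∈ S, |f x y - f x z| < δ) ∧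
      ε < |f u y - f u z| := by
  by_contra! hcon
  obtain ⟨T, hTA, hT⟩ := hA.elim_nhds_subcover
    (fun z => ⋂ x ∈ S, {y | |f x y - f x z| < δ}) (fun z _ => by
      refine (Finset.iInter_mem_sets S).mpr fun x _ => ?_
      refine ((hfY x).sub continuous_const).abs.continuousAt.eventually_lt_const ?_
      simpa using hδ)
  have hnear : ∀ᶠ u in 𝓝 c, ∀ z ∈ T, |f u z - f c z| < ε := by
    refine (Finset.eventually_all T).mpr fun z hz => ?_
    refine ((hfX z (hTA z hz)).sub continuous_const).abs.continuousAt.eventually_lt_const ?_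
    simpa using hε
  obtain ⟨r', hr', hball⟩ := Metric.eventually_nhds_iff_ball.mp hnear
  obtain ⟨u, hu, y, hy, hlt⟩ := hosc c (min r r') (lt_min hr hr')
  obtain ⟨z, hz, hyz⟩ := mem_iUnion₂.mp (hT hy)
  have hS : ∀ x ∈ S, |f x y - f x z| < δ := by simpa using hyz
  have h1 := hcon u (Metric.ball_subset_ball (min_le_left _ _) hu) y hy z (hTA z hz) hS
  have h2 := hcon c (Metric.mem_ball_self hr) y hy z (hTA z hz) hS
  have h3 := hball u (Metric.ball_subset_ball (min_le_right _ _) hu) z hz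
  have : |f u y - f c y| ≤ |f u y - f u z| + |f u z - f c z| + |f c y - f c z| := by
    rw [abs_sub_comm (f c y)]
    exact (abs_sub_le _ (f u z) _).trans
      (by linarith [abs_sub_le (f u z) (f c z) (f c y)])
  linarith

/-- A weak form of Namioka's theorem: a separately continuous function on the product of a complete
pseudometric space and a compact set is, up to `ε`, continuous at some point uniformly over the
compact set. -/
lemma exists_ball_uniform_of_separately_continuous [CompleteSpace X] [Nonempty X] {A : Set Y}
    (hA : IsCompact A) {f : X → Y → ℝ} (hfX : ∀ y ∈ A, Continuous fun x => f x y)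
    (hfY : ∀ x, Continuous (f x)) {ε : ℝ} (hε : 0 < ε) :
    ∃ x r, 0 < r ∧ ∀ x' ∈ Metric.ball x r, ∀ y ∈ A, |f x' y - f x y| ≤ 3 * ε := by
  classical
  by_contra! hosc
  have hpair := fun S δ hδ c r hr =>
    exists_pair_of_oscillation hA hfX hfY hε hosc S (δ := δ) hδ c (r := r) hr
  obtain ⟨-, -, y₀, hy₀, -⟩ := hpair ∅ 1 one_pos (Classical.arbitrary X) 1 one_pos
  -- A stage consists of the points used so far, a ball, and the last pair of points of `A`.
  let Stage := {p : Finset X × (X × ℝ) × Y × Y // 0 < p.2.1.2 ∧ p.2.2.1 ∈ A ∧ p.2.2.2 ∈ A}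
  have step : ∀ s : Stage, ∃ t : Stage,
      (s.1.1 ⊆ t.1.1 ∧ t.1.2.1.1 ∈ t.1.1) ∧ t.1.2.1.2 ≤ s.1.2.1.2 / 2 ∧
      Metric.closedBall t.1.2.1.1 t.1.2.1.2 ⊆ Metric.closedBall s.1.2.1.1 s.1.2.1.2 ∧
      (∀ x ∈ s.1.1, |f x t.1.2.2.1 - f x t.1.2.2.2| < s.1.2.1.2) ∧
      ∀ x ∈ Metric.closedBall t.1.2.1.1 t.1.2.1.2, ε ≤ |f x t.1.2.2.1 - f x t.1.2.2.2| := by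
    rintro ⟨⟨S, ⟨c, r⟩, y', z'⟩, hr, -, -⟩
    obtain ⟨u, hu, y, hy, z, hz, hS, hlt⟩ := hpair S r hr c r hr
    have hnear : ∀ᶠ x in 𝓝 u, ε < |f x y - f x z| ∧ x ∈ Metric.ball c r :=
      (((hfX y hy).sub (hfX z hz)).abs.continuousAt.eventually_const_lt hlt).and
        (Metric.isOpen_ball.mem_nhds hu)
    obtain ⟨ρ, hρ, hball⟩ := Metric.nhds_basis_closedBall.eventually_iff.mp hnear
    refine ⟨⟨⟨insert u S, ⟨u, min ρ (r / 2)⟩, y, z⟩, lt_min hρ (half_pos hr), hy, hz⟩,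
      ⟨Finset.subset_insert _ _, Finset.mem_insert_self _ _⟩, min_le_right _ _, ?_, hS, ?_⟩
    · exact fun x hx => Metric.ball_subset_closedBall
        (hball (Metric.closedBall_subset_closedBall (min_le_left _ _) hx)).2
    · exact fun x hx => (hball (Metric.closedBall_subset_closedBall (min_le_left _ _) hx)).1.le
  choose next hmem hrad hsub hclose hfar using step
  let s : ℕ → Stage := fun n =>
    next^[n] ⟨⟨∅, ⟨Classical.arbitrary X, 1⟩, y₀, y₀⟩, one_pos, hy₀, hy₀⟩
  have hs : ∀ n, s (n + 1) = next (s n) := fun n => Function.iterate_succ_apply' _ _ _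
  set c : ℕ → X := fun n => (s n).1.2.1.1 with hc
  set r : ℕ → ℝ := fun n => (s n).1.2.1.2 with hr
  have hrpos : ∀ n, 0 < r n := fun n => (s n).2.1
  have hrle : ∀ n, r n ≤ (1 / 2) ^ n := by
    intro n
    induction n with
    | zero => simp [hr, s]
    | succ n ih =>
      have h := hrad (s n)
      rw [← hs] at h
      rw [pow_succ]
      change r (n + 1) ≤ _
      change r (n + 1) ≤ r n / 2 at h
      linarith
  have hrlim : Tendsto r atTop (𝓝 0) :=
    squeeze_zero (fun n => (hrpos n).le) hrle
      (tendsto_pow_atTop_nhds_zero_of_lt_one (by norm_num) (by norm_num))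
  have hanti : Antitone fun n => Metric.closedBall (c n) (r n) :=
    antitone_nat_of_succ_le fun n => by
      have h := hsub (s n)
      rw [← hs] at h
      exact h
  have hSmono : Monotone fun n => (s n).1.1 :=
    monotone_nat_of_le_succ fun n => by
      have h := (hmem (s n)).1
      rw [← hs] at h
      exact h
  have hcmem : ∀ m n, n ≤ m → c m ∈ Metric.closedBall (c n) (r n) := fun m n h =>
    hanti h (Metric.mem_closedBall_self (hrpos m).le)
  have hcauchy : CauchySeq c :=
    cauchySeq_of_le_tendsto_0' r (fun n m h => by
      rw [dist_comm]; exact Metric.mem_closedBall.mp (hcmem m n h)) hrlim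
  obtain ⟨a, ha⟩ := cauchySeq_tendsto_of_complete hcauchy
  have hamem : ∀ n, a ∈ Metric.closedBall (c n) (r n) := fun n =>
    Metric.isClosed_closedBall.mem_of_tendsto ha
      ((eventually_ge_atTop n).mono fun m hm => hcmem m n hm)
  let U : Ultrafilter ℕ := Ultrafilter.of atTop
  have hU : (U : Filter ℕ) ≤ atTop := Ultrafilter.of_le _
  obtain ⟨y, hyA, hy⟩ := hA.ultrafilter_le_nhds (U.map fun n => (s n).1.2.2.1)
    (le_principal_iff.mpr (Ultrafilter.mem_map.mpr (univ_mem' fun n => (s n).2.2.1)))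
  obtain ⟨z, hzA, hz⟩ := hA.ultrafilter_le_nhds (U.map fun n => (s n).1.2.2.2)
    (le_principal_iff.mpr (Ultrafilter.mem_map.mpr (univ_mem' fun n => (s n).2.2.2)))
  have hlim : ∀ x, Tendsto (fun n => |f x (s n).1.2.2.1 - f x (s n).1.2.2.2|) U
      (𝓝 |f x y - f x z|) := fun x =>
    ((((hfY x).tendsto y).comp hy).sub (((hfY x).tendsto z).comp hz)).abs
  have hzero : ∀ n, f (c (n + 1)) y = f (c (n + 1)) z := by
    intro n
    have h0 : Tendsto (fun m => |f (c (n + 1)) (s m).1.2.2.1 - f (c (n + 1)) (s m).1.2.2.2|)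
        atTop (𝓝 0) := by
      rw [← tendsto_add_atTop_iff_nat 1]
      refine squeeze_zero' (Eventually.of_forall fun _ => abs_nonneg _) ?_ hrlim
      filter_upwards [eventually_ge_atTop (n + 1)] with m hm
      have h1 : c (n + 1) ∈ (s (n + 1)).1.1 := by
        have h := (hmem (s n)).2
        rw [← hs] at h
        exact h
      have h2 := hclose (s m) _ (hSmono hm h1)
      rw [← hs] at h2
      exact h2.le
    have := tendsto_nhds_unique (hlim _) (h0.mono_left hU)
    exact sub_eq_zero.mp (abs_eq_zero.mp this)
  have hazero : f a y = f a z :=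
    tendsto_nhds_unique_of_eventuallyEq
      (((hfX y hyA).tendsto a).comp (ha.comp (tendsto_add_atTop_nat 1)))
      (((hfX z hzA).tendsto a).comp (ha.comp (tendsto_add_atTop_nat 1)))
      (Eventually.of_forall hzero)
  have hge : ε ≤ |f a y - f a z| := by
    refine ge_of_tendsto (hlim a) ?_
    filter_upwards [hU (eventually_ge_atTop 1)] with n hn
    obtain ⟨m, rfl⟩ := Nat.exists_eq_add_of_le' hn
    have h1 := hamem (m + 1)
    rw [hs]
    refine hfar (s m) a ?_
    rw [← hs]
    exact h1
  rw [hazero, sub_self, abs_zero] at hge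
  linarith

end JointContinuity

/-! ### Weak compactness of the unit ball of `L_∞` -/

section UnitBall

variable {Ω : Type*} [MeasurableSpace Ω] {P : Measure Ω} {Φ : ℝ → ℝ}

lemma abs_integral_mul_le {g v : Ω → ℝ} {C : ℝ} (hg : ∀ ω, |g ω| ≤ C) (hv : Integrable v P) :
    |∫ ω, g ω * v ω ∂P| ≤ C * ∫ ω, |v ω| ∂P := by
  rw [← integral_const_mul, ← Real.norm_eq_abs]
  refine norm_integral_le_of_norm_le (hv.abs.const_mul C) (ae_of_all _ fun ω => ?_)
  rw [Real.norm_eq_abs, abs_mul]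
  exact mul_le_mul_of_nonneg_right (hg ω) (abs_nonneg _)

lemma integral_abs_le_norm [IsProbabilityMeasure P] (v : Lp ℝ 2 P) :
    ∫ ω, |v ω| ∂P ≤ ‖v‖ := by
  have h : ∫ ω, |v ω| ∂P = (eLpNorm v 1 P).toReal := by
    rw [eLpNorm_one_eq_lintegral_enorm]
    exact integral_norm_eq_lintegral_enorm (Lp.aestronglyMeasurable v)
  rw [h, Lp.norm_def]
  exact ENNReal.toReal_mono (Lp.eLpNorm_ne_top v)
    (eLpNorm_le_eLpNorm_of_exponent_le (by norm_num) (Lp.aestronglyMeasurable v))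

/-- The limit, along an ultrafilter on the unit ball of `L_∞`, of the integrals against square
integrable functions is represented by a square integrable function. -/
lemma exists_L2_limit [IsProbabilityMeasure P] (U : Ultrafilter (Ω → ℝ))
    (hU : ∀ᶠ g in (U : Filter (Ω → ℝ)), Measurable g ∧ ∀ ω, |g ω| ≤ 1) :
    ∃ w : Lp ℝ 2 P, ∀ v : Lp ℝ 2 P,
      Tendsto (fun g : Ω → ℝ => ∫ ω, g ω * v ω ∂P) U (𝓝 (∫ ω, w ω * v ω ∂P)) := by
  have hint : ∀ v : Lp ℝ 2 P, Integrable v P := fun v =>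
    (Lp.memLp v).integrable (by norm_num)
  have hmul : ∀ g : Ω → ℝ, (Measurable g ∧ ∀ ω, |g ω| ≤ 1) → ∀ v : Lp ℝ 2 P,
      Integrable (fun ω => g ω * v ω) P := fun g hg v =>
    (hint v).bdd_mul hg.1.aestronglyMeasurable (ae_of_all _ hg.2)
  have hex : ∀ v : Lp ℝ 2 P, ∃ a : ℝ, |a| ≤ ‖v‖ ∧
      Tendsto (fun g : Ω → ℝ => ∫ ω, g ω * v ω ∂P) U (𝓝 a) := by
    intro v
    obtain ⟨a, ha, hlim⟩ := (isCompact_Icc (a := -‖v‖) (b := ‖v‖)).ultrafilter_le_nhds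
      (U.map fun g : Ω → ℝ => ∫ ω, g ω * v ω ∂P) (by
        refine le_principal_iff.mpr (Ultrafilter.mem_map.mpr ?_)
        filter_upwards [hU] with g hg
        refine abs_le.mp ((abs_integral_mul_le hg.2 (hint v)).trans ?_)
        rw [one_mul]
        exact integral_abs_le_norm v)
    exact ⟨a, abs_le.mpr ha, hlim⟩
  choose l hl hlim using hex
  let T : Lp ℝ 2 P →ₗ[ℝ] ℝ :=
    { toFun := l
      map_add' := fun v w => by
        refine tendsto_nhds_unique (hlim (v + w)) (((hlim v).add (hlim w)).congr' ?_)
        filter_upwards [hU] with g hg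
        rw [← integral_add (hmul g hg v) (hmul g hg w)]
        refine integral_congr_ae ?_
        filter_upwards [Lp.coeFn_add v w] with ω hω
        rw [hω, Pi.add_apply, mul_add]
      map_smul' := fun c v => by
        refine tendsto_nhds_unique (hlim (c • v)) (((hlim v).const_mul c).congr fun g => ?_)
        rw [← integral_const_mul]
        refine integral_congr_ae ?_
        filter_upwards [Lp.coeFn_smul c v] with ω hω
        rw [hω, Pi.smul_apply, smul_eq_mul, mul_left_comm] }
  let T' : StrongDual ℝ (Lp ℝ 2 P) := T.mkContinuous 1 (fun v => by simpa [T] using hl v)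
  refine ⟨(InnerProductSpace.toDual ℝ (Lp ℝ 2 P)).symm T', fun v => ?_⟩
  have h : l v = inner ℝ ((InnerProductSpace.toDual ℝ (Lp ℝ 2 P)).symm T') v := by
    rw [InnerProductSpace.toDual_symm_apply]
    rfl
  convert hlim v using 2
  rw [h, L2.inner_def]
  simp [mul_comm]

lemma exists_weak_limit [IsProbabilityMeasure P] (U : Ultrafilter (Ω → ℝ))
    (hU : ∀ᶠ g in (U : Filter (Ω → ℝ)), Measurable g ∧ ∀ ω, |g ω| ≤ 1) :
    ∃ η : Ω → ℝ, Measurable η ∧ (∀ ω, |η ω| ≤ 1) ∧ ∀ ξ : Ω → ℝ, Measurable ξ → Integrable ξ P →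
      Tendsto (fun g : Ω → ℝ => ∫ ω, g ω * ξ ω ∂P) U (𝓝 (∫ ω, η ω * ξ ω ∂P)) := by
  obtain ⟨w, hw⟩ := exists_L2_limit (P := P) U hU
  have hw' : ∀ v : Ω → ℝ, MemLp v 2 P →
      Tendsto (fun g : Ω → ℝ => ∫ ω, g ω * v ω ∂P) U (𝓝 (∫ ω, w ω * v ω ∂P)) := by
    intro v hv
    have hcongr : ∀ g : Ω → ℝ, ∫ ω, g ω * hv.toLp v ω ∂P = ∫ ω, g ω * v ω ∂P := fun g =>
      integral_congr_ae (by filter_upwards [hv.coeFn_toLp] with ω hω; rw [hω])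
    simpa only [hcongr] using hw (hv.toLp v)
  have hwint : Integrable w P := (Lp.memLp w).integrable (by norm_num)
  have hset : ∀ s : Set Ω, MeasurableSet s →
      Tendsto (fun g : Ω → ℝ => ∫ ω in s, g ω ∂P) U (𝓝 (∫ ω in s, w ω ∂P)) := by
    intro s hs
    have hind : ∀ g : Ω → ℝ, ∫ ω, g ω * s.indicator (fun _ => (1 : ℝ)) ω ∂P = ∫ ω in s, g ω ∂P := by
      intro g
      rw [← integral_indicator hs]
      congr with ω
      by_cases h : ω ∈ s <;> simp [h]
    simpa only [hind] using hw' (s.indicator fun _ => 1) (memLp_indicator_const 2 hs 1 (by simp))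
  have hgint : ∀ g : Ω → ℝ, (Measurable g ∧ ∀ ω, |g ω| ≤ 1) → Integrable g P := fun g hg =>
    Integrable.of_bound hg.1.aestronglyMeasurable 1 (ae_of_all _ hg.2)
  have hle : w ≤ᵐ[P] fun _ => (1 : ℝ) := by
    refine ae_le_of_forall_setIntegral_le hwint (integrable_const _) fun s hs _ => ?_
    refine le_of_tendsto (hset s hs) ?_
    filter_upwards [hU] with g hg
    exact integral_mono (hgint g hg).integrableOn (integrable_const _)
      fun ω => (abs_le.mp (hg.2 ω)).2
  have hge : (fun _ => (-1 : ℝ)) ≤ᵐ[P] w := by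
    refine ae_le_of_forall_setIntegral_le (integrable_const _) hwint fun s hs _ => ?_
    refine ge_of_tendsto (hset s hs) ?_
    filter_upwards [hU] with g hg
    exact integral_mono (integrable_const _) (hgint g hg).integrableOn
      fun ω => (abs_le.mp (hg.2 ω)).1
  have hwm : Measurable w := (Lp.stronglyMeasurable w).measurable
  let η : Ω → ℝ := fun ω => max (-1) (min 1 (w ω))
  have hηm : Measurable η := measurable_const.max (measurable_const.min hwm)
  have hη1 : ∀ ω, |η ω| ≤ 1 := fun ω =>
    abs_le.mpr ⟨le_max_left _ _, max_le (by norm_num) (min_le_left _ _)⟩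
  have hηw : η =ᵐ[P] w := by
    filter_upwards [hle, hge] with ω h1 h2
    simp only [η]
    rw [min_eq_right h1, max_eq_right h2]
  refine ⟨η, hηm, hη1, fun ξ hξm hξ => Metric.tendsto_nhds.mpr fun ε hε => ?_⟩
  obtain ⟨M, -, hM⟩ := exists_integral_indicator_lt hξ.abs hξm.abs (ε := ε / 3) (by positivity)
  let B : Set Ω := {ω | M < |ξ ω|}
  have hB : MeasurableSet B := measurableSet_lt measurable_const hξm.abs
  have hbdd : MemLp (Bᶜ.indicator ξ) 2 P := by
    refine MemLp.of_bound (hξm.indicator hB.compl).aestronglyMeasurable |M| (ae_of_all _ fun ω => ?_)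
    by_cases h : ω ∈ B
    · simp [h]
    · rw [indicator_of_mem (mem_compl h)]
      exact (not_lt.mp h).trans (le_abs_self M)
  have hsplit : ∀ g : Ω → ℝ, (Measurable g ∧ ∀ ω, |g ω| ≤ 1) →
      |∫ ω, g ω * ξ ω ∂P - ∫ ω, g ω * Bᶜ.indicator ξ ω ∂P| < ε / 3 := by
    intro g hg
    have hBint : Integrable (B.indicator ξ) P := hξ.indicator hB
    have h1 : ∫ ω, g ω * ξ ω ∂P - ∫ ω, g ω * Bᶜ.indicator ξ ω ∂P
        = ∫ ω, g ω * B.indicator ξ ω ∂P := by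
      rw [← integral_sub (hξ.bdd_mul hg.1.aestronglyMeasurable (ae_of_all _ hg.2))
        ((hξ.indicator hB.compl).bdd_mul hg.1.aestronglyMeasurable (ae_of_all _ hg.2))]
      refine integral_congr_ae (ae_of_all _ fun ω => ?_)
      by_cases h : ω ∈ B <;> simp [h]
    rw [h1]
    refine (abs_integral_mul_le hg.2 hBint).trans_lt ?_
    rw [one_mul]
    refine lt_of_eq_of_lt (integral_congr_ae (ae_of_all _ fun ω => ?_)) hM
    dsimp only
    by_cases h : ω ∈ B
    · rw [indicator_of_mem h]
      exact (indicator_of_mem h fun ω => |ξ ω|).symm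
    · rw [indicator_of_notMem h, abs_zero]
      exact (indicator_of_notMem h fun ω => |ξ ω|).symm
  have hlim : Tendsto (fun g : Ω → ℝ => ∫ ω, g ω * Bᶜ.indicator ξ ω ∂P) U
      (𝓝 (∫ ω, η ω * Bᶜ.indicator ξ ω ∂P)) := by
    convert hw' _ hbdd using 2
    exact integral_congr_ae (by filter_upwards [hηw] with ω hω; rw [hω])
  filter_upwards [hU, Metric.tendsto_nhds.mp hlim (ε / 3) (by positivity)] with g hg hgη
  have h1 := hsplit g hg
  have h2 := hsplit η ⟨hηm, hη1⟩
  rw [Real.dist_eq] at hgη ⊢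
  rw [abs_lt] at *
  constructor <;> linarith [h1.1, h1.2, h2.1, h2.2, hgη.1, hgη.2]

/-- The unit ball of `L_∞`, as a subset of `L_Φ`. -/
def linfBall (P : Measure Ω) (Φ : ℝ → ℝ) : Set (Orlicz P Φ) := {η | ∀ ω, |η.1 ω| ≤ 1}

lemma linfBall_mem_dualSets [IsProbabilityMeasure P] (hΦ : IsYoung Φ) :
    linfBall P Φ ∈ dualSets P (Orlicz P (conj Φ)) (Orlicz P Φ) := by
  have himage : Subtype.val '' linfBall P Φ = {η : Ω → ℝ | Measurable η ∧ ∀ ω, |η ω| ≤ 1} := by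
    ext η
    constructor
    · rintro ⟨η, hη, rfl⟩
      exact ⟨η.2.1, hη⟩
    · rintro ⟨hm, hη⟩
      exact ⟨⟨η, memOrlicz_of_abs_le hΦ hm hη⟩, hη, rfl⟩
  refine ⟨?_, ?_, ?_⟩
  · rw [himage]
    rintro f ⟨hfm, hf⟩ g ⟨hgm, hg⟩ a b ha hb hab
    refine ⟨(hfm.const_smul a).add (hgm.const_smul b), fun ω => ?_⟩
    exact abs_le.mpr (convex_Icc (-1 : ℝ) 1 (abs_le.mp (hf ω)) (abs_le.mp (hg ω)) ha hb hab)
  · rw [himage]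
    rintro a ha _ ⟨f, ⟨hfm, hf⟩, rfl⟩
    refine ⟨hfm.const_smul a, fun ω => ?_⟩
    simp only [Pi.smul_apply, smul_eq_mul, abs_mul]
    exact mul_le_one₀ ha (abs_nonneg _) (hf ω)
  · refine (@isCompact_iff_ultrafilter_le_nhds _ (weakT P (Orlicz P Φ) (Orlicz P (conj Φ))) _).mpr
      fun U hU => ?_
    obtain ⟨η, hηm, hη, hlim⟩ := exists_weak_limit (P := P) (U.map Subtype.val) (by
      refine Ultrafilter.mem_map.mpr ?_
      filter_upwards [le_principal_iff.mp hU] with η hη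
      exact ⟨η.2.1, hη⟩)
    refine ⟨⟨η, memOrlicz_of_abs_le hΦ hηm hη⟩, hη, ?_⟩
    rw [weakT, nhds_induced]
    refine tendsto_iff_comap.mp (tendsto_pi_nhds.mpr fun ξ => ?_)
    exact (hlim ξ.1 ξ.2.1 (integrable_of_memOrlicz_conj hΦ ξ.2)).comp tendsto_map

end UnitBall

/-! ### The topology of convergence in probability and the Mackey topology -/

section Topologies

variable {Ω : Type*} [MeasurableSpace Ω] {P : Measure Ω} {Φ : ℝ → ℝ}

lemma integrable_min_abs_sub [IsFiniteMeasure P] {f g : Ω → ℝ} (hf : Measurable f)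
    (hg : Measurable g) : Integrable (fun ω => min |f ω - g ω| 1) P := by
  refine Integrable.of_bound ((hf.sub hg).abs.min measurable_const).aestronglyMeasurable 1
    (ae_of_all _ fun ω => ?_)
  rw [Real.norm_eq_abs, abs_of_nonneg (le_min (abs_nonneg _) zero_le_one)]
  exact min_le_right _ _

lemma probDist_self (f : Ω → ℝ) : probDist P f f = 0 := by
  simp [probDist]

lemma probDist_comm (f g : Ω → ℝ) : probDist P f g = probDist P g f := by
  simp only [probDist, abs_sub_comm]

lemma probDist_triangle [IsFiniteMeasure P] {f g h : Ω → ℝ} (hf : Measurable f)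
    (hg : Measurable g) (hh : Measurable h) :
    probDist P f h ≤ probDist P f g + probDist P g h := by
  have h1 := integrable_min_abs_sub (P := P) hf hg
  have h2 := integrable_min_abs_sub (P := P) hg hh
  unfold probDist
  rw [← integral_add h1 h2]
  refine integral_mono (integrable_min_abs_sub hf hh) (h1.add h2) fun ω => ?_
  have htri := abs_sub_le (f ω) (g ω) (h ω)
  have := abs_nonneg (f ω - g ω)
  have := abs_nonneg (g ω - h ω)
  dsimp only [Pi.add_apply]
  rcases min_cases |f ω - g ω| 1 with ⟨e1, _⟩ | ⟨e1, _⟩ <;>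
    rcases min_cases |g ω - h ω| 1 with ⟨e2, _⟩ | ⟨e2, _⟩ <;>
    rcases min_cases |f ω - h ω| 1 with ⟨e3, _⟩ | ⟨e3, _⟩ <;> rw [e1, e2, e3] <;> linarith

/-- The pseudometric of convergence in probability on a set of measurable functions. -/
@[reducible]
def probPseudoMetric (P : Measure Ω) [IsFiniteMeasure P] (E : Set (Ω → ℝ))
    (hE : ∀ f ∈ E, Measurable f) : PseudoMetricSpace E where
  dist f g := probDist P f.1 g.1
  dist_self f := probDist_self f.1
  dist_comm f g := probDist_comm f.1 g.1
  dist_triangle f g h := probDist_triangle (hE _ f.2) (hE _ g.2) (hE _ h.2)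

lemma probT_eq [IsFiniteMeasure P] (E : Set (Ω → ℝ)) (hE : ∀ f ∈ E, Measurable f) :
    probT P E = (probPseudoMetric P E hE).toUniformSpace.toTopologicalSpace := by
  let _ := probPseudoMetric P E hE
  have hball : ∀ (f : E) (ε : ℝ), {g : E | probDist P f.1 g.1 < ε} = Metric.ball f ε := by
    intro f ε
    ext g
    rw [Metric.mem_ball, dist_comm]
    rfl
  refine le_antisymm (le_of_nhds_le_nhds fun f => ?_) (le_generateFrom ?_)
  · refine Metric.nhds_basis_ball.ge_iff.mpr fun ε hε => ?_
    have hopen : IsOpen[probT P E] (Metric.ball f ε) :=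
      TopologicalSpace.isOpen_generateFrom_of_mem ⟨f, ε, hε, (hball f ε).symm⟩
    exact @IsOpen.mem_nhds _ (probT P E) f _ hopen (Metric.mem_ball_self hε)
  · rintro _ ⟨f, ε, -, rfl⟩
    rw [hball]
    exact Metric.isOpen_ball

lemma tendsto_nhds_probT_iff [IsFiniteMeasure P] {E : Set (Ω → ℝ)} (hE : ∀ f ∈ E, Measurable f)
    {ι : Type*} {l : Filter ι} {u : ι → E} {f : E} :
    Tendsto u l (@nhds _ (probT P E) f) ↔
      ∀ ε > 0, ∀ᶠ i in l, probDist P (u i).1 f.1 < ε := by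
  rw [probT_eq E hE]
  let _ := probPseudoMetric P E hE
  exact Metric.tendsto_nhds

lemma tendsto_nhds_weakT_iff {E F : Set (Ω → ℝ)} {ι : Type*} {l : Filter ι} {u : ι → E} {f : E} :
    Tendsto u l (@nhds _ (weakT P E F) f) ↔
      ∀ η : F, Tendsto (fun i => pairing P (u i).1 η.1) l (𝓝 (pairing P f.1 η.1)) := by
  rw [weakT, nhds_induced, tendsto_comap_iff]
  exact tendsto_pi_nhds

lemma tendsto_nhds_mackeyT_iff {E F : Set (Ω → ℝ)} {ι : Type*} {l : Filter ι} {u : ι → E} {f : E} :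
    Tendsto u l (@nhds _ (mackeyT P E F) f) ↔ ∀ A ∈ dualSets P E F, ∀ ε > 0,
      ∀ᶠ i in l, ∀ η ∈ A, |pairing P f.1 η.1 - pairing P (u i).1 η.1| < ε := by
  rw [mackeyT, nhds_induced, tendsto_comap_iff, UniformOnFun.tendsto_iff_tendstoUniformlyOn]
  refine forall₂_congr fun A _ => ?_
  rw [Metric.tendstoUniformlyOn_iff]
  rfl

lemma induced_le_induced_of_tendsto {α β : Type*} {t₁ t₂ : TopologicalSpace β} {j : α → β}
    (h : ∀ a, Tendsto j (comap j (@nhds _ t₁ (j a))) (@nhds _ t₂ (j a))) :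
    TopologicalSpace.induced j t₁ ≤ TopologicalSpace.induced j t₂ := by
  refine le_of_nhds_le_nhds fun a => ?_
  rw [@nhds_induced _ _ t₁, @nhds_induced _ _ t₂]
  exact tendsto_iff_comap.mp (h a)

lemma measurable_of_mem_orlicz : ∀ f ∈ Orlicz P Φ, Measurable f := fun _ hf => hf.1

lemma pairing_sub_eq (hΦ : IsYoung Φ) {f g η : Ω → ℝ} (hf : MemOrlicz P (conj Φ) f)
    (hg : MemOrlicz P (conj Φ) g) (hη : MemOrlicz P Φ η) :
    pairing P f η - pairing P g η = ∫ ω, (f ω - g ω) * η ω ∂P := by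
  unfold pairing
  rw [← integral_sub (integrable_mul_of_memOrlicz hΦ hf hη) (integrable_mul_of_memOrlicz hΦ hg hη)]
  simp only [sub_mul]

theorem mackeyT_le_probT [IsProbabilityMeasure P] (hΦ : IsYoung Φ) :
    mackeyT P (Orlicz P (conj Φ)) (Orlicz P Φ) ≤ probT P (Orlicz P (conj Φ)) := by
  refine le_of_nhds_le_nhds fun f => ?_
  refine (tendsto_nhds_probT_iff measurable_of_mem_orlicz (u := id)).mpr fun ε hε => ?_
  filter_upwards [tendsto_nhds_mackeyT_iff.mp tendsto_id _ (linfBall_mem_dualSets hΦ) ε hε]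
    with g hg
  let s : Ω → ℝ := fun ω => if 0 ≤ f.1 ω - g.1 ω then 1 else -1
  have hd : Measurable fun ω => f.1 ω - g.1 ω := f.2.1.sub g.2.1
  have hsm : Measurable s :=
    Measurable.ite (measurableSet_le measurable_const hd) measurable_const measurable_const
  have hs : ∀ ω, |s ω| ≤ 1 := fun ω => by
    simp only [s]
    split_ifs <;> simp
  have hsO : MemOrlicz P Φ s := memOrlicz_of_abs_le hΦ hsm hs
  have h := hg ⟨s, hsO⟩ hs
  rw [id, pairing_sub_eq hΦ f.2 g.2 hsO] at h
  refine lt_of_le_of_lt ?_ ((le_abs_self _).trans_lt h)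
  rw [id, probDist_comm]
  have hint : Integrable (fun ω => f.1 ω - g.1 ω) P :=
    (integrable_of_memOrlicz_conj hΦ f.2).sub (integrable_of_memOrlicz_conj hΦ g.2)
  refine integral_mono (integrable_min_abs_sub f.2.1 g.2.1)
    (hint.mul_bdd hsm.aestronglyMeasurable (ae_of_all _ hs)) fun ω => (min_le_left _ _).trans ?_
  simp only [s]
  split_ifs with h0
  · rw [abs_of_nonneg h0, mul_one]
  · rw [abs_of_neg (not_le.mp h0), mul_neg, mul_one]

end Topologies

section OrderIntervals

variable {Ω : Type*} [MeasurableSpace Ω] {P : Measure Ω} {Φ : ℝ → ℝ}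

lemma mem_Icc_toL1_iff {ζ : Ω → ℝ} (hζ : Integrable ζ P) (u : Ω →₁[P] ℝ) :
    u ∈ Icc (-hζ.toL1 ζ) (hζ.toL1 ζ) ↔ ∀ᵐ ω ∂P, |u ω| ≤ ζ ω := by
  rw [mem_Icc, ← Lp.coeFn_le, ← Lp.coeFn_le]
  have hneg := Lp.coeFn_neg (hζ.toL1 ζ)
  have hto := hζ.coeFn_toL1
  constructor
  · rintro ⟨h1, h2⟩
    filter_upwards [h1, h2, hneg, hto] with ω h1 h2 h3 h4
    rw [h3, Pi.neg_apply, h4] at h1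
    rw [h4] at h2
    exact abs_le.mpr ⟨h1, h2⟩
  · intro h
    constructor
    · filter_upwards [h, hneg, hto] with ω h h3 h4
      rw [h3, Pi.neg_apply, h4]
      exact (abs_le.mp h).1
    · filter_upwards [h, hto] with ω h h4
      rw [h4]
      exact (abs_le.mp h).2

/-- On an order interval, integration against an element of `L_Φ` is `L_1`-continuous. -/
lemma exists_abs_integral_lt {ζ η : Ω → ℝ} (hηm : Measurable η)
    (hζη : Integrable (fun ω => ζ ω * η ω) P) {ε : ℝ} (hε : 0 < ε) :
    ∃ r > 0, ∀ h : Ω → ℝ, Measurable h → Integrable h P → (∀ᵐ ω ∂P, |h ω| ≤ ζ ω) →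
      ∫ ω, |h ω| ∂P < r → |∫ ω, h ω * η ω ∂P| < ε := by
  obtain ⟨M, hM1, hM⟩ := exists_integral_indicator_lt hζη.abs hηm.abs (half_pos hε)
  have hM0 : 0 < M := by linarith
  refine ⟨ε / (2 * M), by positivity, fun h hhm hh hle hlt => ?_⟩
  have hB : MeasurableSet {ω | M < |η ω|} := measurableSet_lt measurable_const hηm.abs
  have hbound : |∫ ω, h ω * η ω ∂P| ≤
      ∫ ω, (M * |h ω| + {ω | M < |η ω|}.indicator (fun ω => |ζ ω * η ω|) ω) ∂P := by
    rw [← Real.norm_eq_abs]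
    refine norm_integral_le_of_norm_le ((hh.abs.const_mul M).add (hζη.abs.indicator hB)) ?_
    filter_upwards [hle] with ω hω
    rw [Real.norm_eq_abs, abs_mul]
    by_cases hη : M < |η ω|
    · rw [indicator_of_mem (by exact hη), abs_mul]
      have h1 := mul_le_mul_of_nonneg_right (hω.trans (le_abs_self (ζ ω))) (abs_nonneg (η ω))
      have h2 : 0 ≤ M * |h ω| := by positivity
      linarith
    · rw [indicator_of_notMem (by exact hη), add_zero, mul_comm]
      exact mul_le_mul_of_nonneg_right (not_lt.mp hη) (abs_nonneg _)
  rw [integral_add (hh.abs.const_mul M) (hζη.abs.indicator hB), integral_const_mul] at hbound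
  rw [lt_div_iff₀ (by positivity)] at hlt
  linarith

/-- A weakly compact subset of `L_Φ` is uniformly small on the elements of an order interval of
`L_{Φ*}` that are small in `L_1`. -/
lemma exists_uniform_bound_of_isCompact [IsProbabilityMeasure P] (hΦ : IsYoung Φ) {ζ : Ω → ℝ}
    (hζ : MemOrlicz P (conj Φ) ζ) (hζ0 : 0 ≤ᵐ[P] ζ) {A : Set (Orlicz P Φ)}
    (hA : @IsCompact _ (weakT P (Orlicz P Φ) (Orlicz P (conj Φ))) A) {ε : ℝ} (hε : 0 < ε) :
    ∃ r > 0, ∀ h : Ω → ℝ, Measurable h → (∀ᵐ ω ∂P, |h ω| ≤ ζ ω) →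
      ∫ ω, |h ω| ∂P < r → ∀ η ∈ A, |∫ ω, h ω * η.1 ω ∂P| ≤ ε := by
  have hζi := integrable_of_memOrlicz_conj hΦ hζ
  let X := Icc (-hζi.toL1 ζ) (hζi.toL1 ζ)
  have : CompleteSpace X := isClosed_Icc.completeSpace_coe
  have hζ1 : ∀ᵐ ω ∂P, |(0 : Ω →₁[P] ℝ) ω| ≤ ζ ω := by
    filter_upwards [hζ0, Lp.coeFn_zero ℝ 1 P] with ω h1 h2
    rw [h2]
    simpa using h1
  have : Nonempty X := ⟨⟨0, (mem_Icc_toL1_iff hζi 0).mpr hζ1⟩⟩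
  have hmeas : ∀ u : X, Measurable u.1 := fun u => (Lp.stronglyMeasurable u.1).measurable
  have hXle : ∀ u : X, ∀ᵐ ω ∂P, |u.1 ω| ≤ ζ ω := fun u => (mem_Icc_toL1_iff hζi u.1).mp u.2
  have hXO : ∀ u : X, MemOrlicz P (conj Φ) u.1 := fun u =>
    MemOrlicz.of_abs_le hΦ one_pos hζ (hmeas u) (by simpa using hXle u)
  have h2ζ : MemOrlicz P (conj Φ) (fun ω => 2 * ζ ω) := by
    refine MemOrlicz.of_abs_le hΦ two_pos hζ (hζ.1.const_mul 2) ?_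
    filter_upwards [hζ0] with ω hω
    rw [abs_of_nonneg (mul_nonneg two_pos.le hω)]
  have hdist : ∀ u v : X, dist u v = ∫ ω, |u.1 ω - v.1 ω| ∂P := fun u v =>
    L1.dist_eq_integral_dist u.1 v.1
  have hX : ∀ η ∈ A, Continuous fun u : X => ∫ ω, η.1 ω * u.1 ω ∂P := by
    intro η _
    refine Metric.continuous_iff.mpr fun v δ hδ => ?_
    obtain ⟨r, hr, hr'⟩ := exists_abs_integral_lt η.2.1
      (integrable_mul_of_memOrlicz hΦ h2ζ η.2) hδ
    refine ⟨r, hr, fun u hu => ?_⟩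
    rw [hdist] at hu
    have h := hr' (fun ω => u.1 ω - v.1 ω) ((hmeas u).sub (hmeas v))
      ((integrable_of_memOrlicz_conj hΦ (hXO u)).sub (integrable_of_memOrlicz_conj hΦ (hXO v)))
      (by
        filter_upwards [hXle u, hXle v] with ω h1 h2
        exact (abs_sub _ _).trans (by linarith)) hu
    rw [← pairing_sub_eq hΦ (hXO u) (hXO v) η.2] at h
    rw [Real.dist_eq]
    simpa only [pairing, mul_comm] using h
  have hY : ∀ u : X, @Continuous _ _ (weakT P (Orlicz P Φ) (Orlicz P (conj Φ))) _
      fun η : Orlicz P Φ => ∫ ω, η.1 ω * u.1 ω ∂P := fun u =>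
    (@continuous_iff_continuousAt _ _ (weakT P (Orlicz P Φ) (Orlicz P (conj Φ))) _ _).mpr
      fun _ => tendsto_nhds_weakT_iff.mp tendsto_id ⟨u.1, hXO u⟩
  obtain ⟨u, r, hr, hur⟩ := @exists_ball_uniform_of_separately_continuous X _ _
    (weakT P (Orlicz P Φ) (Orlicz P (conj Φ))) _ _ A hA _ hX hY (ε / 6) (by positivity)
  refine ⟨r, hr, fun h hhm hle hlt η hη => ?_⟩
  have hhO : MemOrlicz P (conj Φ) h := MemOrlicz.of_abs_le hΦ one_pos hζ hhm (by simpa using hle)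
  have hhi := integrable_of_memOrlicz_conj hΦ hhO
  -- Perturbing `u` by `h` on a set where this does not leave the order interval.
  have key : ∀ (B : Set Ω) (c : ℝ), MeasurableSet B → |c| = 1 →
      (∀ ω ∈ B, c * (u.1 ω * h ω) ≤ 0) → |∫ ω, B.indicator h ω * η.1 ω ∂P| ≤ ε / 2 := by
    intro B c hB hc hsign
    have hBO : MemOrlicz P (conj Φ) (B.indicator h) :=
      MemOrlicz.of_abs_le hΦ one_pos hζ (hhm.indicator hB) (by
        filter_upwards [hle] with ω hω
        rw [one_mul]
        exact (norm_indicator_le_norm_self h ω).trans hω)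
    have hBi := integrable_of_memOrlicz_conj hΦ hBO
    have hvi : Integrable (fun ω => u.1 ω + c * B.indicator h ω) P :=
      (L1.integrable_coeFn u.1).add (hBi.const_mul c)
    let v : Ω →₁[P] ℝ := hvi.toL1 _
    have hv := hvi.coeFn_toL1
    have hvX : v ∈ X := by
      refine (mem_Icc_toL1_iff hζi v).mpr ?_
      filter_upwards [hv, hle, hXle u] with ω h1 h2 h3
      rw [h1]
      by_cases hω : ω ∈ B
      · rw [indicator_of_mem hω]
        have h4 : |c * h ω| ≤ ζ ω := by rw [abs_mul, hc, one_mul]; exact h2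
        have h5 : u.1 ω * (c * h ω) ≤ 0 := by linarith [hsign ω hω]
        rw [abs_le] at h3 h4 ⊢
        rcases mul_nonpos_iff.mp h5 with h6 | h6 <;> constructor <;> linarith
      · rwa [indicator_of_notMem hω, mul_zero, add_zero]
    have hvball : (⟨v, hvX⟩ : X) ∈ Metric.ball u r := by
      rw [Metric.mem_ball, hdist]
      refine lt_of_le_of_lt (integral_mono_ae
        ((L1.integrable_coeFn v).sub (L1.integrable_coeFn u.1)).abs hhi.abs ?_) hlt
      filter_upwards [hv] with ω h1
      dsimp only [v]
      rw [h1, add_sub_cancel_left, abs_mul, hc, one_mul]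
      exact norm_indicator_le_norm_self h ω
    have hle' := hur ⟨v, hvX⟩ hvball η hη
    have heq : ∫ ω, η.1 ω * v ω ∂P - ∫ ω, η.1 ω * u.1 ω ∂P
        = c * ∫ ω, B.indicator h ω * η.1 ω ∂P := by
      have := pairing_sub_eq hΦ (hXO ⟨v, hvX⟩) (hXO u) η.2
      simp only [pairing] at this
      simp only [mul_comm (η.1 _)]
      rw [this, ← integral_const_mul]
      refine integral_congr_ae ?_
      filter_upwards [hv] with ω h1
      rw [h1]
      ring
    rw [heq, abs_mul, hc, one_mul] at hle'
    linarith
  have hBm : MeasurableSet {ω | u.1 ω * h ω ≤ 0} :=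
    measurableSet_le ((hmeas u).mul hhm) measurable_const
  have h1 := key {ω | u.1 ω * h ω ≤ 0} 1 hBm (by simp) (fun ω hω => by simpa using hω)
  have h2 := key {ω | u.1 ω * h ω ≤ 0}ᶜ (-1) hBm.compl (by simp) (fun ω hω => by
    have : 0 < u.1 ω * h ω := not_le.mp hω
    linarith)
  have hi := integrable_mul_of_memOrlicz hΦ hhO η.2
  have hsum : ∫ ω, h ω * η.1 ω ∂P = ∫ ω, {ω | u.1 ω * h ω ≤ 0}.indicator h ω * η.1 ω ∂P
      + ∫ ω, {ω | u.1 ω * h ω ≤ 0}ᶜ.indicator h ω * η.1 ω ∂P := by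
    simp only [← indicator_mul_left]
    rw [integral_indicator hBm, integral_indicator hBm.compl, integral_add_compl hBm hi]
  rw [hsum]
  exact (abs_add_le _ _).trans (by linarith)

/-- On an order interval, convergence in probability implies convergence in `L_1`. -/
lemma exists_integral_abs_lt_of_probDist [IsFiniteMeasure P] {ζ : Ω → ℝ} (hζm : Measurable ζ)
    (hζ : Integrable ζ P) {ε : ℝ} (hε : 0 < ε) :
    ∃ δ > 0, ∀ f g : Ω → ℝ, Measurable f → Measurable g → (∀ᵐ ω ∂P, |f ω - g ω| ≤ ζ ω) →
      probDist P f g < δ → ∫ ω, |f ω - g ω| ∂P < ε := by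
  obtain ⟨M, hM1, hM⟩ := exists_integral_indicator_lt hζ hζm (half_pos hε)
  have hM0 : 0 < M := by linarith
  have hB : MeasurableSet {ω | M < ζ ω} := measurableSet_lt measurable_const hζm
  refine ⟨ε / (2 * M), by positivity, fun f g hf hg hle hlt => ?_⟩
  have hmin := (integrable_min_abs_sub (P := P) hf hg).const_mul M
  have hbound : ∫ ω, |f ω - g ω| ∂P ≤
      ∫ ω, (M * min |f ω - g ω| 1 + {ω | M < ζ ω}.indicator ζ ω) ∂P := by
    refine integral_mono_of_nonneg (ae_of_all _ fun _ => abs_nonneg _)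
      (hmin.add (hζ.indicator hB)) ?_
    filter_upwards [hle] with ω hω
    have h0 := abs_nonneg (f ω - g ω)
    by_cases h : M < ζ ω
    · rw [indicator_of_mem (by exact h)]
      have : 0 ≤ M * min |f ω - g ω| 1 := by positivity
      linarith
    · rw [indicator_of_notMem (by exact h), add_zero]
      rcases min_cases |f ω - g ω| 1 with ⟨e, _⟩ | ⟨e, _⟩ <;> rw [e]
      · nlinarith
      · linarith [not_lt.mp h]
  rw [integral_add hmin (hζ.indicator hB), integral_const_mul] at hbound
  have hlt' : ∫ ω, min |f ω - g ω| 1 ∂P < ε / (2 * M) := hlt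
  rw [lt_div_iff₀ (by positivity)] at hlt'
  linarith

theorem induced_probT_le_induced_mackeyT [IsProbabilityMeasure P] (hΦ : IsYoung Φ) {ζ : Ω → ℝ}
    (hζ : MemOrlicz P (conj Φ) ζ) (hζ0 : 0 ≤ᵐ[P] ζ) :
    TopologicalSpace.induced
        (Subtype.val : {ξ : Orlicz P (conj Φ) // ∀ᵐ ω ∂P, |ξ.1 ω| ≤ ζ ω} → _)
        (probT P (Orlicz P (conj Φ))) ≤
      TopologicalSpace.induced Subtype.val (mackeyT P (Orlicz P (conj Φ)) (Orlicz P Φ)) := by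
  have h2ζ : MemOrlicz P (conj Φ) (fun ω => 2 * ζ ω) := by
    refine MemOrlicz.of_abs_le hΦ two_pos hζ (hζ.1.const_mul 2) ?_
    filter_upwards [hζ0] with ω hω
    rw [abs_of_nonneg (mul_nonneg two_pos.le hω)]
  refine induced_le_induced_of_tendsto fun f => tendsto_nhds_mackeyT_iff.mpr fun A hA ε hε => ?_
  obtain ⟨r, hr, hbound⟩ := exists_uniform_bound_of_isCompact hΦ h2ζ
    (by filter_upwards [hζ0] with ω hω using mul_nonneg two_pos.le hω) hA.2.2 (half_pos hε)
  obtain ⟨δ, hδ, hL1⟩ := exists_integral_abs_lt_of_probDist h2ζ.1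
    (integrable_of_memOrlicz_conj hΦ h2ζ) hr
  filter_upwards [(tendsto_nhds_probT_iff measurable_of_mem_orlicz).mp tendsto_comap δ hδ]
    with g hg η hη
  have hle : ∀ᵐ ω ∂P, |f.1.1 ω - g.1.1 ω| ≤ 2 * ζ ω := by
    filter_upwards [f.2, g.2] with ω h1 h2
    exact (abs_sub _ _).trans (by linarith)
  rw [probDist_comm] at hg
  rw [pairing_sub_eq hΦ f.1.2 g.1.2 η.2]
  have := hbound (fun ω => f.1.1 ω - g.1.1 ω) (f.1.2.1.sub g.1.2.1) hle
    (hL1 _ _ f.1.2.1 g.1.2.1 hle hg) η hη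
  linarith

end OrderIntervals

/-! ### The `Δ₂`-condition -/

section UnitBallOfDual

variable {Ω : Type*} [MeasurableSpace Ω] {P : Measure Ω} {Φ : ℝ → ℝ}

lemma integrable_two_mul_of_delta2 [IsFiniteMeasure P] (hΦ : IsYoung Φ) (hΔ : Delta2 Φ)
    {η : Ω → ℝ} (hη : Measurable η) (h : Integrable (fun ω => Φ (η ω)) P) :
    Integrable (fun ω => Φ (2 * η ω)) P := by
  obtain ⟨C, x₀, hC⟩ := hΔ
  have hcont := continuous_of_convexOn hΦ.convexOn
  refine ((h.const_mul |C|).add (integrable_const (Φ (2 * x₀)))).mono'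
    (hcont.measurable.comp (hη.const_mul 2)).aestronglyMeasurable (ae_of_all _ fun ω => ?_)
  have habs : ∀ c : ℝ, 0 < c → Φ (c * |η ω|) = Φ (c * η ω) := fun c hc => by
    rcases abs_choice (η ω) with h | h <;> rw [h]
    rw [mul_neg, hΦ.even]
  have habs1 := habs 1 one_pos
  rw [one_mul, one_mul] at habs1
  rw [Real.norm_eq_abs, abs_of_nonneg (hΦ.nonneg _)]
  rcases le_total x₀ |η ω| with h0 | h0
  · have h1 := hC _ h0
    rw [habs 2 two_pos, habs1] at h1
    have h2 := mul_le_mul_of_nonneg_right (le_abs_self C) (hΦ.nonneg (η ω))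
    have h3 := hΦ.nonneg (2 * x₀)
    simp only [Pi.add_apply]
    linarith
  · have h1 : Φ (2 * η ω) ≤ Φ (2 * x₀) := by
      refine apply_le_of_abs_le hΦ.even hΦ.convexOn ?_
      rw [abs_mul, abs_mul]
      exact mul_le_mul_of_nonneg_left (h0.trans (le_abs_self _)) (abs_nonneg _)
    have h2 := mul_nonneg (abs_nonneg C) (hΦ.nonneg (η ω))
    simp only [Pi.add_apply]
    linarith

/-- Under the `Δ₂`-condition, elements of `L_Φ` have finite modulars at arbitrarily large scales. -/
lemma exists_integrable_large_scale [IsFiniteMeasure P] (hΦ : IsYoung Φ) (hΔ : Delta2 Φ)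
    {η : Ω → ℝ} (hη : MemOrlicz P Φ η) (K : ℝ) :
    ∃ c > K, 0 < c ∧ Integrable (fun ω => Φ (c * η ω)) P := by
  obtain ⟨hm, l, hl, h⟩ := hη
  have hpow : ∀ n : ℕ, Integrable (fun ω => Φ (2 ^ n * l * η ω)) P := by
    intro n
    induction n with
    | zero =>
      simpa using integrable_of_lintegral_ofReal (continuous_of_convexOn hΦ.convexOn) hΦ.nonneg
        (hm.const_mul l) h
    | succ n ih =>
      convert integrable_two_mul_of_delta2 hΦ hΔ (hm.const_mul _) ih using 3
      ring
  have hlim : Tendsto (fun n : ℕ => (2 : ℝ) ^ n * l) atTop atTop :=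
    (tendsto_pow_atTop_atTop_of_one_lt one_lt_two).atTop_mul_const hl
  obtain ⟨n, hn⟩ := (hlim.eventually_gt_atTop K).exists
  exact ⟨2 ^ n * l, hn, by positivity, hpow n⟩

/-- The pointwise estimate behind the weak continuity on the unit ball of `L_{Φ*}`. -/
lemma abs_sub_mul_le (hΦ : IsYoung Φ) {c M x y z t : ℝ} (hc : 0 < c) (hM : 0 ≤ M) (ht : 0 ≤ t)
    (htz : M < max (Φ (c * z)) |z| → t = Φ (c * z)) :
    |(x - y) * z| ≤ (M + 2 * M / c) * min |x - y| 1 + (conj Φ x + conj Φ y) / c + 2 / c * t := by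
  have hx := conj_nonneg hΦ x
  have hy := conj_nonneg hΦ y
  have hmin : 0 ≤ min |x - y| 1 := le_min (abs_nonneg _) zero_le_one
  have hsum : 0 ≤ (conj Φ x + conj Φ y) / c := by positivity
  have hMc : 0 ≤ 2 * M / c * min |x - y| 1 := by positivity
  have hMm : 0 ≤ M * min |x - y| 1 := by positivity
  have hct : 0 ≤ 2 / c * t := by positivity
  have hyoung : |(x - y) * z| ≤ (conj Φ x + conj Φ y) / c + 2 / c * Φ (c * z) := by
    have h1 := hΦ.abs_mul_le (c * z) x
    have h2 := hΦ.abs_mul_le (c * z) y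
    have h3 : c * |(x - y) * z| = |c * z * x - c * z * y| := by
      conv_lhs => rw [← abs_of_pos hc, ← abs_mul]
      ring_nf
    have h4 := abs_sub (c * z * x) (c * z * y)
    rw [div_mul_eq_mul_div, ← add_div, le_div_iff₀ hc, mul_comm]
    linarith
  by_cases hz : M < max (Φ (c * z)) |z|
  · rw [htz hz]
    linarith
  obtain ⟨hz1, hz2⟩ := max_le_iff.mp (not_lt.mp hz)
  by_cases hxy : |x - y| ≤ 1
  · have h1 : |(x - y) * z| ≤ M * min |x - y| 1 := by
      rw [min_eq_left hxy, abs_mul, mul_comm]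
      exact mul_le_mul_of_nonneg_right hz2 (abs_nonneg _)
    linarith
  · rw [min_eq_right (not_le.mp hxy).le]
    have h2 := mul_le_mul_of_nonneg_left hz1 (by positivity : 0 ≤ 2 / c)
    have h4 : 2 / c * M = 2 * M / c := by ring
    linarith

lemma integral_conj_le_one (hΦ : IsYoung Φ) {ξ : Ω → ℝ} (hξ : Measurable ξ)
    (h : ∫⁻ ω, ENNReal.ofReal (conj Φ (ξ ω)) ∂P ≤ 1) :
    Integrable (fun ω => conj Φ (ξ ω)) P ∧ ∫ ω, conj Φ (ξ ω) ∂P ≤ 1 := by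
  have hcont := continuous_of_convexOn (conj_convexOn hΦ)
  refine ⟨integrable_of_lintegral_ofReal hcont (conj_nonneg hΦ) hξ
    (h.trans_lt ENNReal.one_lt_top), ?_⟩
  rw [integral_eq_lintegral_of_nonneg_ae (ae_of_all _ fun _ => conj_nonneg hΦ _)
    (hcont.measurable.comp hξ).aestronglyMeasurable]
  exact ENNReal.toReal_mono ENNReal.one_ne_top h

/-- Under the `Δ₂`-condition, pairing with an element of `L_Φ` is continuous for convergence in
probability on the unit ball of `L_{Φ*}`. -/
lemma exists_pairing_sub_lt_of_probDist [IsFiniteMeasure P] (hΦ : IsYoung Φ) (hΔ : Delta2 Φ)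
    {η : Ω → ℝ} (hη : MemOrlicz P Φ η) {ε : ℝ} (hε : 0 < ε) :
    ∃ δ > 0, ∀ f g : Ω → ℝ, MemOrlicz P (conj Φ) f → MemOrlicz P (conj Φ) g →
      ∫⁻ ω, ENNReal.ofReal (conj Φ (f ω)) ∂P ≤ 1 → ∫⁻ ω, ENNReal.ofReal (conj Φ (g ω)) ∂P ≤ 1 →
      probDist P f g < δ → |pairing P f η - pairing P g η| < ε := by
  obtain ⟨c, hcK, hc, hi⟩ := exists_integrable_large_scale hΦ hΔ hη (8 / ε)
  have hΦm : Measurable fun ω => Φ (c * η ω) :=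
    (continuous_of_convexOn hΦ.convexOn).measurable.comp (hη.1.const_mul c)
  have hψm : Measurable fun ω => max (Φ (c * η ω)) |η ω| := hΦm.max hη.1.abs
  obtain ⟨M, hM1, hlt⟩ := exists_integral_indicator_lt hi hψm one_pos
  have hM : 0 < M := by linarith
  set B : Set Ω := {ω | M < max (Φ (c * η ω)) |η ω|}
  have hB : MeasurableSet B := measurableSet_lt measurable_const hψm
  refine ⟨ε / (2 * (M + 2 * M / c)), by positivity, fun f g hf hg hf1 hg1 hfg => ?_⟩
  obtain ⟨hfi, hf1⟩ := integral_conj_le_one hΦ hf.1 hf1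
  obtain ⟨hgi, hg1⟩ := integral_conj_le_one hΦ hg.1 hg1
  have hI1 := (integrable_min_abs_sub (P := P) hf.1 hg.1).const_mul (M + 2 * M / c)
  have hI2 : Integrable (fun ω => (conj Φ (f ω) + conj Φ (g ω)) / c) P := (hfi.add hgi).div_const c
  have hI3 : Integrable (fun ω => 2 / c * B.indicator (fun ω => Φ (c * η ω)) ω) P :=
    (hi.indicator hB).const_mul (2 / c)
  have hI12 : Integrable (fun ω => (M + 2 * M / c) * min |f ω - g ω| 1
      + (conj Φ (f ω) + conj Φ (g ω)) / c) P := hI1.add hI2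
  have hbound : |∫ ω, (f ω - g ω) * η ω ∂P| ≤
      ∫ ω, ((M + 2 * M / c) * min |f ω - g ω| 1 + (conj Φ (f ω) + conj Φ (g ω)) / c
        + 2 / c * B.indicator (fun ω => Φ (c * η ω)) ω) ∂P := by
    rw [← Real.norm_eq_abs]
    refine norm_integral_le_of_norm_le (hI12.add hI3) (ae_of_all _ fun ω => ?_)
    exact abs_sub_mul_le hΦ hc hM.le (indicator_nonneg (fun _ _ => hΦ.nonneg _) ω)
      fun h => indicator_of_mem (s := B) h _
  rw [integral_add hI12 hI3, integral_add hI1 hI2, integral_const_mul,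
    integral_const_mul, integral_div, integral_add hfi hgi] at hbound
  rw [pairing_sub_eq hΦ hf hg hη]
  have hfg' : ∫ ω, min |f ω - g ω| 1 ∂P < ε / (2 * (M + 2 * M / c)) := hfg
  rw [lt_div_iff₀ (by positivity)] at hfg'
  have h1 : (∫ ω, conj Φ (f ω) ∂P + ∫ ω, conj Φ (g ω) ∂P) / c ≤ 2 / c :=
    div_le_div_of_nonneg_right (by linarith) hc.le
  have h2 : 2 / c * ∫ ω, B.indicator (fun ω => Φ (c * η ω)) ω ∂P ≤ 2 / c * 1 :=
    mul_le_mul_of_nonneg_left hlt.le (by positivity)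
  have h3 : 2 / c < ε / 4 := by
    rw [gt_iff_lt, div_lt_iff₀ hε] at hcK
    rw [div_lt_iff₀ hc]
    linarith
  linarith

theorem induced_probT_le_induced_weakT [IsFiniteMeasure P] (hΦ : IsYoung Φ) (hΔ : Delta2 Φ) :
    TopologicalSpace.induced
        (Subtype.val :
          {ξ : Orlicz P (conj Φ) // ∫⁻ ω, ENNReal.ofReal (conj Φ (ξ.1 ω)) ∂P ≤ 1} → _)
        (probT P (Orlicz P (conj Φ))) ≤
      TopologicalSpace.induced Subtype.val (weakT P (Orlicz P (conj Φ)) (Orlicz P Φ)) := by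
  refine induced_le_induced_of_tendsto fun f => tendsto_nhds_weakT_iff.mpr fun η => ?_
  refine Metric.tendsto_nhds.mpr fun ε hε => ?_
  obtain ⟨δ, hδ, h⟩ := exists_pairing_sub_lt_of_probDist hΦ hΔ η.2 hε
  filter_upwards [(tendsto_nhds_probT_iff measurable_of_mem_orlicz).mp tendsto_comap δ hδ]
    with g hg
  exact h _ _ g.1.2 f.1.2 g.2 f.2 hg

end UnitBallOfDual


/-- (i) `τ(L_{Φ*},L_Φ)` is finer than the topology of
convergence in probability; (ii) on every order interval `[-ζ,ζ]` the two
topologies coincide (in particular `τ(L_{Φ*},L_Φ)` is (pseudo)metrisable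
there); (iii) if `Φ ∈ Δ₂` then on the unit ball `B_{Φ*}` one has
`σ(L_{Φ*},L_Φ) ⊆ τ_{L₀} ⊆ τ(L_{Φ*},L_Φ)`. -/
theorem statement2
    {Ω : Type*} [MeasurableSpace Ω] (P : Measure Ω) [IsProbabilityMeasure P]
    (Φ : ℝ → ℝ) (hΦ : IsYoung Φ) :
    -- (i): Mackey is finer than convergence in probability
    (mackeyT P (Orlicz P (conj Φ)) (Orlicz P Φ) ≤ probT P (Orlicz P (conj Φ))) ∧
    -- (ii): on order intervals the two topologies coincide, and are pseudometrisable
    (∀ ζ : Ω → ℝ, ζ ∈ Orlicz P (conj Φ) → 0 ≤ᵐ[P] ζ →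
      (TopologicalSpace.induced
          (Subtype.val : {ξ : Orlicz P (conj Φ) // ∀ᵐ ω ∂P, |ξ.1 ω| ≤ ζ ω} → _)
          (mackeyT P (Orlicz P (conj Φ)) (Orlicz P Φ)) =
        TopologicalSpace.induced Subtype.val (probT P (Orlicz P (conj Φ)))) ∧
      @TopologicalSpace.PseudoMetrizableSpace
        {ξ : Orlicz P (conj Φ) // ∀ᵐ ω ∂P, |ξ.1 ω| ≤ ζ ω}
        (TopologicalSpace.induced Subtype.val
          (mackeyT P (Orlicz P (conj Φ)) (Orlicz P Φ)))) ∧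
    -- (iii): if Φ ∈ Δ₂, inclusions of the three topologies on the unit ball
    (Delta2 Φ →
      (TopologicalSpace.induced
          (Subtype.val :
            {ξ : Orlicz P (conj Φ) // ∫⁻ ω, ENNReal.ofReal (conj Φ (ξ.1 ω)) ∂P ≤ 1} → _)
          (probT P (Orlicz P (conj Φ))) ≤
        TopologicalSpace.induced Subtype.val (weakT P (Orlicz P (conj Φ)) (Orlicz P Φ))) ∧
      (TopologicalSpace.induced
          (Subtype.val :
            {ξ : Orlicz P (conj Φ) // ∫⁻ ω, ENNReal.ofReal (conj Φ (ξ.1 ω)) ∂P ≤ 1} → _)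
          (mackeyT P (Orlicz P (conj Φ)) (Orlicz P Φ)) ≤
        TopologicalSpace.induced Subtype.val (probT P (Orlicz P (conj Φ))))) := by
  refine ⟨mackeyT_le_probT hΦ, fun ζ hζ hζ0 => ?_, fun hΔ =>
    ⟨induced_probT_le_induced_weakT hΦ hΔ, induced_mono (mackeyT_le_probT hΦ)⟩⟩
  have heq := le_antisymm (induced_mono (mackeyT_le_probT hΦ))
    (induced_probT_le_induced_mackeyT hΦ hζ hζ0)
  refine ⟨heq, ?_⟩
  rw [heq, probT_eq _ measurable_of_mem_orlicz]
  let d := (probPseudoMetric P (Orlicz P (conj Φ)) measurable_of_mem_orlicz).induced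
    (Subtype.val : {ξ : Orlicz P (conj Φ) // ∀ᵐ ω ∂P, |ξ.1 ω| ≤ ζ ω} → _)
  exact @UniformSpace.pseudoMetrizableSpace _ d.toUniformSpace inferInstance

end OrliczPaper
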